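/- Let n ≥ 1, let F be a finite group, and fix finite symmetric generating sets S of ℤⁿ and S' of ℤⁿ × F, each containing the identity. Then there exist a bijection φ : ℤⁿ → ℤⁿ × F and a constant M ≥ 1 such that for all x, y ∈ ℤⁿ: M^{-1}·d_S(x,y) ≤ d_{S'}(φ(x), φ(y)) ≤ M·d_S(x,y). -/

import Mathlib

open scoped Pointwise

/-- The word length of `g` with respect to a symmetric generating set `S` containing the
identity: the least `n` with `g ∈ S^n` (where `S^0 = {1}`). -/
noncomputable def wordLength {G : Type*} [Group G] (S : Set G) (g : G) : ℕ :=
  sInf {n : ℕ | g ∈ S ^ n}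

/-- The word metric `d_S(g,g') = |g⁻¹g'|_S`. -/
noncomputable def wordDist {G : Type*} [Group G] (S : Set G) (g g' : G) : ℕ :=
  wordLength S (g⁻¹ * g')

section WordLength

variable {G : Type*} [Group G] {S : Set G}

lemma wordLength_le_of_mem_pow {m : ℕ} {g : G} (h : g ∈ S ^ m) : wordLength S g ≤ m :=
  Nat.sInf_le h

lemma exists_mem_pow_of_closure_eq_top (hS_symm : S⁻¹ = S) (hS_gen : Subgroup.closure S = ⊤)
    (g : G) : ∃ m : ℕ, g ∈ S ^ m := by
  have hg : g ∈ Subgroup.closure S := hS_gen ▸ Subgroup.mem_top g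
  induction hg using Subgroup.closure_induction with
  | mem x hx => exact ⟨1, by simpa using hx⟩
  | one => exact ⟨0, by simp⟩
  | mul x y _ _ hx hy =>
    obtain ⟨a, ha⟩ := hx
    obtain ⟨b, hb⟩ := hy
    exact ⟨a + b, pow_add S a b ▸ Set.mul_mem_mul ha hb⟩
  | inv x _ hx =>
    obtain ⟨a, ha⟩ := hx
    refine ⟨a, ?_⟩
    rw [← hS_symm, inv_pow]
    simpa using ha

lemma mem_pow_wordLength (hS_symm : S⁻¹ = S) (hS_gen : Subgroup.closure S = ⊤) (g : G) :
    g ∈ S ^ wordLength S g :=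
  Nat.sInf_mem (s := {m : ℕ | g ∈ S ^ m}) (exists_mem_pow_of_closure_eq_top hS_symm hS_gen g)

lemma wordLength_one : wordLength S (1 : G) = 0 :=
  Nat.le_zero.mp (wordLength_le_of_mem_pow (by simp))

lemma wordLength_mul_le (hS_symm : S⁻¹ = S) (hS_gen : Subgroup.closure S = ⊤) (g h : G) :
    wordLength S (g * h) ≤ wordLength S g + wordLength S h := by
  apply wordLength_le_of_mem_pow
  rw [pow_add]
  exact Set.mul_mem_mul (mem_pow_wordLength hS_symm hS_gen g)
    (mem_pow_wordLength hS_symm hS_gen h)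

lemma wordLength_inv_le (hS_symm : S⁻¹ = S) (hS_gen : Subgroup.closure S = ⊤) (g : G) :
    wordLength S g⁻¹ ≤ wordLength S g := by
  apply wordLength_le_of_mem_pow
  rw [← hS_symm, inv_pow, hS_symm]
  simpa using mem_pow_wordLength hS_symm hS_gen g

lemma wordLength_pow_le (hS_symm : S⁻¹ = S) (hS_gen : Subgroup.closure S = ⊤) (g : G) (m : ℕ) :
    wordLength S (g ^ m) ≤ m * wordLength S g := by
  induction m with
  | zero => simp [wordLength_one]
  | succ m ih =>
    rw [pow_succ, add_one_mul]
    exact (wordLength_mul_le hS_symm hS_gen _ _).trans (by gcongr)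

lemma wordLength_zpow_le (hS_symm : S⁻¹ = S) (hS_gen : Subgroup.closure S = ⊤) (g : G) (m : ℤ) :
    wordLength S (g ^ m) ≤ m.natAbs * wordLength S g := by
  rcases Int.natAbs_eq m with h | h
  · rw [h, zpow_natCast, Int.natAbs_natCast]
    exact wordLength_pow_le hS_symm hS_gen g _
  · rw [h, zpow_neg, zpow_natCast, Int.natAbs_neg, Int.natAbs_natCast]
    exact (wordLength_inv_le hS_symm hS_gen _).trans (wordLength_pow_le hS_symm hS_gen g _)

lemma one_le_wordDist (hS_symm : S⁻¹ = S) (hS_gen : Subgroup.closure S = ⊤) {g h : G}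
    (hgh : g ≠ h) : 1 ≤ wordDist S g h := by
  by_contra! h0
  have := mem_pow_wordLength hS_symm hS_gen (g⁻¹ * h)
  rw [show wordLength S (g⁻¹ * h) = 0 from Nat.lt_one_iff.mp h0, pow_zero, Set.mem_one,
    inv_mul_eq_one] at this
  exact hgh this

lemma wordDist_self (g : G) : wordDist S g g = 0 := by
  simp [wordDist, wordLength_one]

end WordLength

/-- The `ℓ¹` norm on `ℤⁿ`, written multiplicatively. -/
def l1Norm {ι : Type*} [Fintype ι] (a : Multiplicative (ι → ℤ)) : ℕ :=
  ∑ i, (a.toAdd i).natAbs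

section L1Norm

variable {ι : Type*} [Fintype ι] {G : Type*} [Group G] {S : Set G}

lemma l1Norm_mul_le (a b : Multiplicative (ι → ℤ)) : l1Norm (a * b) ≤ l1Norm a + l1Norm b := by
  rw [l1Norm, l1Norm, l1Norm, ← Finset.sum_add_distrib]
  exact Finset.sum_le_sum fun i _ => Int.natAbs_add_le _ _

/-- Homomorphisms to `ℤⁿ` are Lipschitz for the word length and the `ℓ¹` norm. -/
lemma exists_l1Norm_map_le (hS_fin : S.Finite) (hS_symm : S⁻¹ = S)
    (hS_gen : Subgroup.closure S = ⊤) (p : G →* Multiplicative (ι → ℤ)) :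
    ∃ C : ℕ, ∀ g, l1Norm (p g) ≤ C * wordLength S g := by
  obtain ⟨C, hC⟩ := (hS_fin.image fun g => l1Norm (p g)).bddAbove
  refine ⟨C, fun g => ?_⟩
  have key : ∀ (m : ℕ) (g : G), g ∈ S ^ m → l1Norm (p g) ≤ C * m := by
    intro m
    induction m with
    | zero =>
      intro g hg
      rw [pow_zero, Set.mem_one] at hg
      simp [hg, l1Norm]
    | succ m ih =>
      intro g hg
      rw [pow_succ] at hg
      obtain ⟨a, ha, b, hb, rfl⟩ := Set.mem_mul.mp hg
      rw [map_mul, mul_add_one]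
      exact (l1Norm_mul_le _ _).trans
        (add_le_add (ih a ha) (hC (Set.mem_image_of_mem _ hb)))
  exact key _ g (mem_pow_wordLength hS_symm hS_gen g)

/-- Homomorphisms from `ℤⁿ` are Lipschitz for the `ℓ¹` norm and the word length. -/
lemma exists_wordLength_map_le (hS_symm : S⁻¹ = S) (hS_gen : Subgroup.closure S = ⊤)
    (f : Multiplicative (ι → ℤ) →* G) :
    ∃ C : ℕ, ∀ a, wordLength S (f a) ≤ C * l1Norm a := by
  classical
  let e (i : ι) : Multiplicative (ι → ℤ) := Multiplicative.ofAdd (Pi.single i 1)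
  refine ⟨∑ i, wordLength S (f (e i)), fun a => ?_⟩
  have key : ∀ s : Finset ι, wordLength S (f (∏ i ∈ s, e i ^ a.toAdd i)) ≤
      ∑ i ∈ s, (a.toAdd i).natAbs * wordLength S (f (e i)) := by
    intro s
    induction s using Finset.induction_on with
    | empty => simp [wordLength_one]
    | insert i s hi ih =>
      rw [Finset.prod_insert hi, Finset.sum_insert hi, map_mul, map_zpow]
      exact (wordLength_mul_le hS_symm hS_gen _ _).trans
        (add_le_add (wordLength_zpow_le hS_symm hS_gen _ _) ih)
  have ha : ∏ i, e i ^ a.toAdd i = a := by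
    apply Multiplicative.toAdd.injective
    rw [toAdd_prod]
    funext j
    simp [e, Finset.sum_apply, Pi.single_apply]
  calc wordLength S (f a)
      ≤ ∑ i, (a.toAdd i).natAbs * wordLength S (f (e i)) := by
        have h := key Finset.univ
        rwa [ha] at h
    _ ≤ ∑ i, (a.toAdd i).natAbs * ∑ j, wordLength S (f (e j)) := by
        gcongr with i
        exact Finset.single_le_sum (f := fun j => wordLength S (f (e j)))
          (fun _ _ => Nat.zero_le _) (Finset.mem_univ i)
    _ = (∑ i, wordLength S (f (e i))) * l1Norm a := by
        rw [← Finset.sum_mul, mul_comm, l1Norm]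

lemma exists_wordLength_le_l1Norm_fst {F : Type*} [Group F] [Finite F]
    {T : Set (Multiplicative (ι → ℤ) × F)} (hT_symm : T⁻¹ = T)
    (hT_gen : Subgroup.closure T = ⊤) :
    ∃ C D : ℕ, ∀ g, wordLength T g ≤ C * l1Norm g.1 + D := by
  obtain ⟨C, hC⟩ := exists_wordLength_map_le hT_symm hT_gen
    (MonoidHom.inl (Multiplicative (ι → ℤ)) F)
  obtain ⟨D, hD⟩ := (Set.finite_range fun x : F =>
    wordLength T (MonoidHom.inr (Multiplicative (ι → ℤ)) F x)).bddAbove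
  refine ⟨C, D, fun g => ?_⟩
  have hg : g = MonoidHom.inl _ F g.1 * MonoidHom.inr _ F g.2 := by simp
  calc wordLength T g ≤ _ := by
        conv_lhs => rw [hg]
        exact wordLength_mul_le hT_symm hT_gen _ _
    _ ≤ C * l1Norm g.1 + D := add_le_add (hC g.1) (hD (Set.mem_range_self g.2))

end L1Norm

section DivMod

variable {ι : Type*} [DecidableEq ι] {F : Type*} {k : ℕ} [NeZero k]

/-- The bijection `ℤⁿ ≃ ℤⁿ × F`, for `F` with `k` elements, which divides the coordinate `i₀`
by `k` and records the remainder as an element of `F`. -/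
def divModCoordEquiv (i₀ : ι) (e : Fin k ≃ F) :
    Multiplicative (ι → ℤ) ≃ Multiplicative (ι → ℤ) × F where
  toFun x := (Multiplicative.ofAdd (Function.update x.toAdd i₀ (x.toAdd i₀ / k)),
    e (Int.divModEquiv k (x.toAdd i₀)).2)
  invFun y := Multiplicative.ofAdd
    (Function.update y.1.toAdd i₀ ((Int.divModEquiv k).symm (y.1.toAdd i₀, e.symm y.2)))
  left_inv x := by
    have h : (x.toAdd i₀ / k, (Int.divModEquiv k (x.toAdd i₀)).2) =
      Int.divModEquiv k (x.toAdd i₀) := rfl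
    simp [h, -Int.divModEquiv_apply, -Int.divModEquiv_symm_apply]
  right_inv y := by
    have h₁ := congrArg Prod.fst
      ((Int.divModEquiv k).apply_symm_apply (y.1.toAdd i₀, e.symm y.2))
    change _ / (k : ℤ) = _ at h₁
    ext1
    · simp [h₁, -Int.divModEquiv_apply, -Int.divModEquiv_symm_apply]
    · simp [-Int.divModEquiv_apply, -Int.divModEquiv_symm_apply]

variable [Fintype ι]

lemma l1Norm_inv_mul_eq (i₀ : ι) (x y : Multiplicative (ι → ℤ)) :
    l1Norm (x⁻¹ * y) = (y.toAdd i₀ - x.toAdd i₀).natAbs +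
      ∑ i ∈ Finset.univ.erase i₀, (y.toAdd i - x.toAdd i).natAbs := by
  rw [l1Norm, ← Finset.add_sum_erase _ _ (Finset.mem_univ i₀)]
  simp [neg_add_eq_sub]

lemma l1Norm_divModCoordEquiv_fst (i₀ : ι) (e : Fin k ≃ F) (x y : Multiplicative (ι → ℤ)) :
    l1Norm ((divModCoordEquiv i₀ e x).1⁻¹ * (divModCoordEquiv i₀ e y).1) =
      (y.toAdd i₀ / k - x.toAdd i₀ / k).natAbs +
        ∑ i ∈ Finset.univ.erase i₀, (y.toAdd i - x.toAdd i).natAbs := by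
  rw [l1Norm_inv_mul_eq i₀]
  congr 1
  · simp [divModCoordEquiv]
  · refine Finset.sum_congr rfl fun i hi => ?_
    simp [divModCoordEquiv, Finset.ne_of_mem_erase hi]

lemma natAbs_ediv_sub_ediv_le (a b : ℤ) : (b / k - a / k).natAbs ≤ (b - a).natAbs + 1 := by
  have hk : (1 : ℤ) ≤ k := by exact_mod_cast NeZero.one_le
  have ha := Int.mul_ediv_add_emod a k
  have hb := Int.mul_ediv_add_emod b k
  have ha₀ := Int.emod_nonneg a (by omega : (k : ℤ) ≠ 0)
  have hb₀ := Int.emod_nonneg b (by omega : (k : ℤ) ≠ 0)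
  have ha₁ := Int.emod_lt_of_pos a (by omega : (0 : ℤ) < k)
  have hb₁ := Int.emod_lt_of_pos b (by omega : (0 : ℤ) < k)
  zify
  have h := abs_le.mp (le_refl |b - a|)
  have h₀ := abs_nonneg (b - a)
  rw [abs_le]
  constructor <;> by_contra! hlt <;> nlinarith

lemma natAbs_sub_le_mul_ediv (a b : ℤ) : (b - a).natAbs ≤ k * ((b / k - a / k).natAbs + 1) := by
  have hk : (1 : ℤ) ≤ k := by exact_mod_cast NeZero.one_le
  have ha := Int.mul_ediv_add_emod a k
  have hb := Int.mul_ediv_add_emod b k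
  have ha₀ := Int.emod_nonneg a (by omega : (k : ℤ) ≠ 0)
  have hb₀ := Int.emod_nonneg b (by omega : (k : ℤ) ≠ 0)
  have ha₁ := Int.emod_lt_of_pos a (by omega : (0 : ℤ) < k)
  have hb₁ := Int.emod_lt_of_pos b (by omega : (0 : ℤ) < k)
  zify
  have h := abs_le.mp (le_refl |b / (k : ℤ) - a / k|)
  rw [abs_le]
  constructor <;> nlinarith

lemma l1Norm_divModCoordEquiv_le (i₀ : ι) (e : Fin k ≃ F) (x y : Multiplicative (ι → ℤ)) :
    l1Norm ((divModCoordEquiv i₀ e x).1⁻¹ * (divModCoordEquiv i₀ e y).1) ≤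
      l1Norm (x⁻¹ * y) + 1 := by
  rw [l1Norm_divModCoordEquiv_fst, l1Norm_inv_mul_eq i₀]
  have := natAbs_ediv_sub_ediv_le (k := k) (x.toAdd i₀) (y.toAdd i₀)
  omega

lemma l1Norm_le_mul_divModCoordEquiv (i₀ : ι) (e : Fin k ≃ F) (x y : Multiplicative (ι → ℤ)) :
    l1Norm (x⁻¹ * y) ≤
      k * (l1Norm ((divModCoordEquiv i₀ e x).1⁻¹ * (divModCoordEquiv i₀ e y).1) + 1) := by
  rw [l1Norm_divModCoordEquiv_fst, l1Norm_inv_mul_eq i₀]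
  have h := natAbs_sub_le_mul_ediv (k := k) (x.toAdd i₀) (y.toAdd i₀)
  have hk : 1 ≤ k := NeZero.one_le
  nlinarith [Nat.le_mul_of_pos_left
    (∑ i ∈ Finset.univ.erase i₀, (y.toAdd i - x.toAdd i).natAbs) hk]

end DivMod

/-- for every `n ≥ 1` and every finite group `F`, the groups `ℤⁿ` and `ℤⁿ × F`
are bilipschitz equivalent via a bijection, with respect to any fixed finite symmetric
generating sets containing the identity. -/
theorem zn_bilipschitz_zn_times_finite (n : ℕ) (hn : 1 ≤ n) (F : Type*) [Group F] [Finite F]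
    (S : Set (Multiplicative (Fin n → ℤ)))
    (S' : Set (Multiplicative (Fin n → ℤ) × F))
    (hS_fin : S.Finite) (hS_symm : S⁻¹ = S)
    (hS_one : (1 : Multiplicative (Fin n → ℤ)) ∈ S)
    (hS_gen : Subgroup.closure S = ⊤)
    (hS'_fin : S'.Finite) (hS'_symm : S'⁻¹ = S')
    (hS'_one : (1 : Multiplicative (Fin n → ℤ) × F) ∈ S')
    (hS'_gen : Subgroup.closure S' = ⊤) :
    ∃ (φ : Multiplicative (Fin n → ℤ) → Multiplicative (Fin n → ℤ) × F) (M : ℝ),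
      1 ≤ M ∧ Function.Bijective φ ∧
      ∀ x y : Multiplicative (Fin n → ℤ),
        M⁻¹ * (wordDist S x y : ℝ) ≤ (wordDist S' (φ x) (φ y) : ℝ) ∧
        (wordDist S' (φ x) (φ y) : ℝ) ≤ M * (wordDist S x y : ℝ) := by
  obtain ⟨A, hA⟩ := exists_l1Norm_map_le hS_fin hS_symm hS_gen (MonoidHom.id _)
  obtain ⟨B, hB⟩ := exists_wordLength_map_le hS_symm hS_gen (MonoidHom.id _)
  obtain ⟨A', hA'⟩ := exists_l1Norm_map_le hS'_fin hS'_symm hS'_gen (MonoidHom.fst _ F)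
  obtain ⟨B', D', hB'⟩ := exists_wordLength_le_l1Norm_fst hS'_symm hS'_gen
  let i₀ : Fin n := ⟨0, hn⟩
  have : NeZero (Nat.card F) := ⟨Nat.card_pos.ne'⟩
  let k := Nat.card F
  let φ := divModCoordEquiv i₀ (Finite.equivFin F).symm
  let U := B * (k * (A' + 1))
  let V := B' * (A + 1) + D'
  have hUV (x y : Multiplicative (Fin n → ℤ)) : wordDist S x y ≤ U * wordDist S' (φ x) (φ y) ∧
      wordDist S' (φ x) (φ y) ≤ V * wordDist S x y := by
    rcases eq_or_ne x y with rfl | hxy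
    · simp [wordDist_self]
    have h₁ := one_le_wordDist hS_symm hS_gen hxy
    have h₂ := one_le_wordDist hS'_symm hS'_gen (φ.injective.ne hxy)
    constructor
    · calc wordDist S x y ≤ B * l1Norm (x⁻¹ * y) := hB _
        _ ≤ B * (k * (l1Norm ((φ x).1⁻¹ * (φ y).1) + 1)) := by
          gcongr
          exact l1Norm_le_mul_divModCoordEquiv i₀ _ x y
        _ ≤ B * (k * (A' * wordDist S' (φ x) (φ y) + wordDist S' (φ x) (φ y))) := by
          gcongr
          exact hA' ((φ x)⁻¹ * φ y)
        _ = U * wordDist S' (φ x) (φ y) := by ring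
    · calc wordDist S' (φ x) (φ y) ≤ B' * l1Norm ((φ x).1⁻¹ * (φ y).1) + D' := hB' _
        _ ≤ B' * (l1Norm (x⁻¹ * y) + 1) + D' * 1 := by
          rw [mul_one]
          gcongr
          exact l1Norm_divModCoordEquiv_le i₀ _ x y
        _ ≤ B' * (A * wordDist S x y + wordDist S x y) + D' * wordDist S x y := by
          gcongr
          exact hA (x⁻¹ * y)
        _ = V * wordDist S x y := by ring
  refine ⟨φ, ((U + V + 1 : ℕ) : ℝ), by exact_mod_cast Nat.le_add_left 1 (U + V), φ.bijective,
    fun x y => ⟨?_, ?_⟩⟩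
  · rw [inv_mul_le_iff₀ (by positivity)]
    exact_mod_cast (hUV x y).1.trans (Nat.mul_le_mul_right _ (by omega))
  · exact_mod_cast (hUV x y).2.trans (Nat.mul_le_mul_right _ (by omega))
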